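/- There is a universal constant C > 0 such that the following holds. Let (X,d) be a finite metric space, let s : X → ℝ satisfy s(v) > 0 for all v and |s(v) − s(u)| ≤ d(v,u) for all u,v ∈ X, and let L ≥ 1. Suppose that for every integer t there is a map f_t : X → ℓ1 such that ‖f_t(v)‖₁ = 2^t for all v ∈ X, ‖f_t(v) − f_t(u)‖₁ ≤ L·d(v,u) for all u,v ∈ X, and ‖f_t(v) − f_t(u)‖₁ ≥ min{d(v,u), 2^t} for all u,v ∈ X. Then there exists f : X → ℓ1 such that: (1) ‖f(v)‖₁ = s(v) for every v ∈ X; (2) ‖f(v) − f(u)‖₁ ≤ C·L·d(v,u) for all u,v ∈ X; and (3) for every c ≥ 1 and every u,v ∈ X with min{s(v), s(u)} ≥ d(u,v)/c, it holds that ‖f(v) − f(u)‖₁ ≥ d(v,u)/(12c). -/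

import Mathlib

noncomputable section

/-- The space `ℓ₁` of absolutely summable real sequences. -/
abbrev ℓ1 : Type := lp (fun _ : ℕ => ℝ) 1

lemma glue_exists (T : Finset ℤ) : ∃ Φ : (ℤ → ℓ1) → ℓ1,
    (∀ G H, Φ G - Φ H = Φ (fun t => G t - H t)) ∧ ∀ G, ‖Φ G‖ = ∑ t ∈ T, ‖G t‖ := by
  classical
  let e : ℤ × ℕ ≃ ℕ := Denumerable.eqv (ℤ × ℕ)
  let P : (ℤ → ℓ1) → ℤ × ℕ → ℝ := fun G p => if p.1 ∈ T then G p.1 p.2 else 0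
  have hs : ∀ x : ℓ1, HasSum (fun i => ‖x i‖) ‖x‖ := by
    intro x
    have := lp.hasSum_norm (p := 1) (by norm_num) x
    simpa using this
  have hrow : ∀ G t, HasSum (fun m => ‖P G (t, m)‖) (if t ∈ T then ‖G t‖ else 0) := by
    intro G t
    by_cases h : t ∈ T
    · simpa [P, h] using hs (G t)
    · simp [P, h, hasSum_zero]
  have hsum : ∀ G, Summable (fun p => ‖P G p‖) := by
    intro G
    rw [summable_prod_of_nonneg (fun p => norm_nonneg _)]
    refine ⟨fun t => (hrow G t).summable, ?_⟩
    apply summable_of_ne_finset_zero (s := T)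
    intro t ht
    rw [(hrow G t).tsum_eq, if_neg ht]
  have htot : ∀ G, ∑' p, ‖P G p‖ = ∑ t ∈ T, ‖G t‖ := by
    intro G
    rw [(hsum G).tsum_prod' (fun t => (hrow G t).summable)]
    simp_rw [fun t => (hrow G t).tsum_eq]
    rw [tsum_eq_sum (s := T)]
    · exact Finset.sum_congr rfl fun t ht => if_pos ht
    · intro t ht
      exact if_neg ht
  have hmem : ∀ G, Memℓp (fun n : ℕ => P G (e.symm n)) 1 := by
    intro G
    apply memℓp_gen
    have := (e.symm.summable_iff (f := fun p => ‖P G p‖)).2 (hsum G)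
    simpa [Function.comp_def] using this
  refine ⟨fun G => ⟨fun n => P G (e.symm n), hmem G⟩, ?_, ?_⟩
  · intro G H
    ext n
    simp only [P, lp.coeFn_sub, Pi.sub_apply]
    split_ifs <;> simp
  · intro G
    rw [← htot G, ← e.symm.tsum_eq]
    exact (hs ⟨fun n => P G (e.symm n), hmem G⟩).tsum_eq.symm

/-- The tent function. -/
def tent (y : ℝ) : ℝ := max 0 (min (2 * y - 1) (2 - y))

lemma tent_nonneg (y : ℝ) : 0 ≤ tent y := le_max_left _ _

lemma tent_lip (y z : ℝ) : |tent y - tent z| ≤ 2 * |y - z| := by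
  unfold tent
  grind

lemma tent_scaled (a b : ℝ) (t : ℤ) :
    |tent (a / 2 ^ t) - tent (b / 2 ^ t)| * 2 ^ t ≤ 2 * |a - b| := by
  have h2 : (0 : ℝ) < 2 ^ t := by positivity
  have := tent_lip (a / 2 ^ t) (b / 2 ^ t)
  rw [← sub_div, abs_div, abs_of_pos h2] at this
  calc _ ≤ 2 * (|a - b| / 2 ^ t) * 2 ^ t := by gcongr
    _ = _ := by field_simp

lemma tent_at (a : ℝ) (k : ℤ) (h1 : (2 : ℝ) ^ k ≤ a) (h2 : a < (2 : ℝ) ^ (k + 1)) :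
    tent (a / 2 ^ k) = 2 - a / 2 ^ k ∧ tent (a / 2 ^ (k + 1)) = a / 2 ^ k - 1 ∧
    ∀ t, t ≠ k → t ≠ k + 1 → tent (a / 2 ^ t) = 0 := by
  have hk : (0 : ℝ) < 2 ^ k := by positivity
  have e1 : (2 : ℝ) ^ (k + 1) = 2 ^ k * 2 := zpow_add_one₀ (by norm_num) k
  have y1 : 1 ≤ a / 2 ^ k := by rwa [le_div_iff₀ hk, one_mul]
  have y2 : a / 2 ^ k < 2 := by rw [div_lt_iff₀ hk]; linarith
  refine ⟨?_, ?_, ?_⟩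
  · unfold tent; grind
  · rw [e1, ← div_div]
    unfold tent; grind
  · intro t ht1 ht2
    have ht : (0 : ℝ) < 2 ^ t := by positivity
    have key : 2 ≤ a / 2 ^ t ∨ a / 2 ^ t ≤ 1 / 2 := by
      rcases lt_or_gt_of_ne ht1 with h | h
      · left
        rw [le_div_iff₀ ht]
        have : (2 : ℝ) ^ (t + 1) ≤ 2 ^ k := zpow_le_zpow_right₀ (by norm_num) (by omega)
        rw [zpow_add_one₀ (by norm_num)] at this
        linarith
      · right
        rw [div_le_iff₀ ht]
        have : (2 : ℝ) ^ (k + 1 + 1) ≤ 2 ^ t := zpow_le_zpow_right₀ (by norm_num) (by omega)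
        rw [zpow_add_one₀ (by norm_num)] at this
        linarith
    unfold tent; grind

/-- There is a universal constant `C > 0` such that the following holds.  Let `(X,d)` be
a finite metric space, let `s : X → ℝ` be positive and `1`-Lipschitz, and let `L ≥ 1`.
Suppose that for every integer `t` there is a uniformly truncated embedding
`F t : X → ℓ₁` with truncation `2 ^ t`: `‖F t v‖ = 2 ^ t`, `F t` is `L`-Lipschitz, and
`‖F t v - F t u‖ ≥ min {d(v,u), 2 ^ t}`.  Then there is `f : X → ℓ₁` with `‖f v‖ = s v`
for every `v`, which is `C·L`-Lipschitz, and such that for every `c ≥ 1` and every pair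
`u, v` with `min {s v, s u} ≥ d(u,v)/c` one has `‖f v - f u‖ ≥ d(v,u)/(12c)`. -/
theorem nonuniform_truncation :
    ∃ C : ℝ, 0 < C ∧
      ∀ (X : Type) (_ : Fintype X) (_ : MetricSpace X)
        (s : X → ℝ), (∀ v : X, 0 < s v) → (∀ u v : X, |s v - s u| ≤ dist v u) →
      ∀ L : ℝ, 1 ≤ L →
      ∀ F : ℤ → X → ℓ1,
        (∀ (t : ℤ) (v : X), ‖F t v‖ = (2 : ℝ) ^ t) →
        (∀ (t : ℤ) (u v : X), ‖F t v - F t u‖ ≤ L * dist v u) →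
        (∀ (t : ℤ) (u v : X), min (dist v u) ((2 : ℝ) ^ t) ≤ ‖F t v - F t u‖) →
        ∃ f : X → ℓ1,
          (∀ v : X, ‖f v‖ = s v) ∧
          (∀ u v : X, ‖f v - f u‖ ≤ C * L * dist v u) ∧
          (∀ c : ℝ, 1 ≤ c → ∀ u v : X, dist u v / c ≤ min (s v) (s u) →
            dist v u / (12 * c) ≤ ‖f v - f u‖) := by
  refine ⟨9, by norm_num, ?_⟩
  intro X _ _ s hs hlip L hL F hnorm hup hlow
  classical
  let k : X → ℤ := fun v => Int.log 2 (s v)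
  have hk1 : ∀ v, (2 : ℝ) ^ k v ≤ s v := fun v => by
    simpa using Int.zpow_log_le_self (b := 2) (by norm_num) (hs v)
  have hk2 : ∀ v, s v < (2 : ℝ) ^ (k v + 1) := fun v => by
    simpa using Int.lt_zpow_succ_log_self (b := 2) (by norm_num) (s v)
  let T : Finset ℤ := Finset.univ.image k ∪ Finset.univ.image (fun v => k v + 1)
  have hT1 : ∀ v, k v ∈ T := fun v => by simp [T]
  have hT2 : ∀ v, k v + 1 ∈ T := fun v => by simp [T]
  obtain ⟨Φ, hsub, hΦ⟩ := glue_exists T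
  let ρ : ℤ → X → ℝ := fun t v => tent (s v / 2 ^ t)
  have hρ0 : ∀ t v, 0 ≤ ρ t v := fun t v => tent_nonneg _
  have hρk : ∀ v, ρ (k v) v = 2 - s v / 2 ^ k v := fun v => (tent_at _ _ (hk1 v) (hk2 v)).1
  have hρk1 : ∀ v, ρ (k v + 1) v = s v / 2 ^ k v - 1 :=
    fun v => (tent_at _ _ (hk1 v) (hk2 v)).2.1
  have hρz : ∀ v t, t ≠ k v → t ≠ k v + 1 → ρ t v = 0 :=
    fun v => (tent_at _ _ (hk1 v) (hk2 v)).2.2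
  have hρl : ∀ t u v, |ρ t v - ρ t u| * 2 ^ t ≤ 2 * |s v - s u| :=
    fun t u v => tent_scaled _ _ _
  have hsum : ∀ v (g : ℤ → ℝ), ∑ t ∈ T, ρ t v * g t
      = ρ (k v) v * g (k v) + ρ (k v + 1) v * g (k v + 1) := by
    intro v g
    rw [← Finset.sum_pair (f := fun t => ρ t v * g t) (by omega : k v ≠ k v + 1)]
    symm
    apply Finset.sum_subset
    · intro t ht
      simp only [Finset.mem_insert, Finset.mem_singleton] at ht
      rcases ht with rfl | rfl
      · exact hT1 v
      · exact hT2 v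
    · intro t _ ht
      simp only [Finset.mem_insert, Finset.mem_singleton, not_or] at ht
      rw [hρz v t ht.1 ht.2, zero_mul]
  let f : X → ℓ1 := fun v => Φ (fun t => ρ t v • F t v)
  have hfn : ∀ v, ‖f v‖ = s v := by
    intro v
    simp only [f, hΦ, norm_smul, Real.norm_eq_abs, hnorm, abs_of_nonneg (hρ0 _ _)]
    rw [hsum v (fun t => 2 ^ t), hρk, hρk1, zpow_add_one₀ (by norm_num)]
    have : (0 : ℝ) < 2 ^ k v := by positivity
    field_simp
    ring
  have hfd : ∀ u v, ‖f v - f u‖ = ∑ t ∈ T, ‖ρ t v • F t v - ρ t u • F t u‖ := by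
    intro u v
    simp only [f, hsub, hΦ]
  have hdec : ∀ t u v, ρ t v • F t v - ρ t u • F t u
      = ρ t v • (F t v - F t u) + (ρ t v - ρ t u) • F t u := by
    intro t u v
    rw [smul_sub, sub_smul]; abel
  have hn1 : ∀ t u v, ‖ρ t v • (F t v - F t u)‖ = ρ t v * ‖F t v - F t u‖ := by
    intro t u v
    rw [norm_smul, Real.norm_eq_abs, abs_of_nonneg (hρ0 _ _)]
  have hn2 : ∀ t u v, ‖(ρ t v - ρ t u) • F t u‖ = |ρ t v - ρ t u| * 2 ^ t := by
    intro t u v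
    rw [norm_smul, Real.norm_eq_abs, hnorm]
  refine ⟨f, hfn, ?_, ?_⟩
  · intro u v
    rw [hfd]
    have hd : 0 ≤ dist v u := dist_nonneg
    have A : ∑ t ∈ T, ‖ρ t v • F t v - ρ t u • F t u‖
        ≤ ∑ t ∈ T, ρ t v * (L * dist v u) + ∑ t ∈ T, |ρ t v - ρ t u| * 2 ^ t := by
      rw [← Finset.sum_add_distrib]
      apply Finset.sum_le_sum
      intro t _
      rw [hdec]
      refine (norm_add_le _ _).trans ?_
      rw [hn1, hn2]
      gcongr
      · exact hρ0 _ _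
      · exact hup t u v
    have B : ∑ t ∈ T, ρ t v * (L * dist v u) = L * dist v u := by
      rw [hsum v (fun _ => L * dist v u), hρk, hρk1]; ring
    have D : ∑ t ∈ T, |ρ t v - ρ t u| * 2 ^ t ≤ 8 * dist v u := by
      let S : Finset ℤ := {k v, k v + 1, k u, k u + 1}
      have hS : S ⊆ T := by
        intro t ht
        simp only [S, Finset.mem_insert, Finset.mem_singleton] at ht
        rcases ht with rfl | rfl | rfl | rfl
        · exact hT1 v
        · exact hT2 v
        · exact hT1 u
        · exact hT2 u
      rw [← Finset.sum_subset hS]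
      · have h4 : (S.card : ℝ) ≤ 4 := by exact_mod_cast Finset.card_le_four
        calc _ ≤ ∑ t ∈ S, 2 * dist v u := by
              apply Finset.sum_le_sum
              intro t _
              linarith [hρl t u v, hlip u v]
          _ = S.card * (2 * dist v u) := by simp
          _ ≤ 4 * (2 * dist v u) := by gcongr
          _ = _ := by ring
      · intro t _ ht
        simp only [S, Finset.mem_insert, Finset.mem_singleton, not_or] at ht
        obtain ⟨h1, h2, h3, h4⟩ := ht
        rw [hρz v t h1 h2, hρz u t h3 h4]; simp
    have : dist v u ≤ L * dist v u := le_mul_of_one_le_left hd hL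
    linarith
  · intro c hc u v hm
    have hc0 : 0 < c := by linarith
    rw [dist_comm u v] at hm
    have hd : 0 ≤ dist v u := dist_nonneg
    have e12 : dist v u / (12 * c) = dist v u / c / 12 := by rw [mul_comm, div_div]
    rw [e12]
    have hDd : dist v u / c ≤ dist v u := div_le_self hd hc
    have hDv : dist v u / c ≤ s v := hm.trans (min_le_left _ _)
    have hD0 : 0 ≤ dist v u / c := by positivity
    set D := dist v u / c with hDdef
    by_cases hcase : D / 12 ≤ |s v - s u|
    · have := abs_norm_sub_norm_le (f v) (f u)
      rw [hfn, hfn] at this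
      linarith
    · push Not at hcase
      have key : ∀ t ∈ T, 1 / 2 ≤ ρ t v → s v / 2 ≤ 2 ^ t → D / 12 ≤ ‖f v - f u‖ := by
        intro t ht h1 h2
        rw [hfd]
        refine le_trans ?_ (Finset.single_le_sum
          (f := fun t => ‖ρ t v • F t v - ρ t u • F t u‖) (fun _ _ => norm_nonneg _) ht)
        show D / 12 ≤ ‖ρ t v • F t v - ρ t u • F t u‖
        rw [hdec]
        have a1 := norm_sub_le_norm_add (ρ t v • (F t v - F t u)) ((ρ t v - ρ t u) • F t u)
        rw [hn1, hn2] at a1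
        have a2 := hρl t u v
        have a3 : D / 2 ≤ ‖F t v - F t u‖ :=
          le_trans (le_min (by linarith) (by linarith)) (hlow t u v)
        have a4 : 1 / 2 * (D / 2) ≤ ρ t v * ‖F t v - F t u‖ := by gcongr
        linarith
      have g1 := hk1 v
      have g2 := hk2 v
      have g0 : (0 : ℝ) < 2 ^ k v := by positivity
      rw [zpow_add_one₀ (by norm_num)] at g2
      by_cases hh : 1 / 2 ≤ ρ (k v) v
      · exact key _ (hT1 v) hh (by linarith)
      · refine key _ (hT2 v) ?_ ?_
        · rw [hρk1]; rw [hρk] at hh; linarith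
        · rw [zpow_add_one₀ (by norm_num)]; linarith
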